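/- For the invariant 3-form γ = a e^{135} + b e^{246} + Σ(Q₁)_ij de^{2i−1}∧e^{2j} + Σ(Q₂)_ij e^{2i−1}∧de^{2j} on S³×S³ and ω determined by matrix P, Hitchin's endomorphism J_γ squares to −(1/det P)²·((ab − tr(Q₁ᵀQ₂))² + 4(a det Q₂ + b det Q₁) − 4 tr(Adj(Q₁ᵀQ₂)))·Id on the coframe. In particular J_γ² = −Id if and only if (det P)² = −(ab − tr(Q₁ᵀQ₂))² − 4(a det Q₂ + b det Q₁) + 4 tr(Adj(Q₁ᵀQ₂)). -/

import Mathlib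

open Matrix

/-- 3×3 real matrices. -/
abbrev M3 : Type := Matrix (Fin 3) (Fin 3) ℝ

/-- Hitchin's endomorphism `J_γ` expressed on the invariant coframe `e¹,…,e⁶` of `S³×S³`
(column `l` = input coframe element, row `k` = output component), following
`J e^{2r−1} = (1/det P)[(ab − tr(Q₂Q₁ᵀ))e^{2r−1} + 2Σᵢ((Q₂Q₁ᵀ)_{ri}e^{2i−1}
  − (aQ₂ − Adj(Q₁ᵀ))_{ri}e^{2i})]` and
`J e^{2r} = (1/det P)[−(ab − tr(Q₁ᵀQ₂))e^{2r} + 2Σᵢ((bQ₁ᵀ − Adj(Q₂))_{ri}e^{2i−1}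
  − (Q₁ᵀQ₂)_{ri}e^{2i})]`. -/
noncomputable def Jmat (a b : ℝ) (P Q1 Q2 : M3) : Matrix (Fin 6) (Fin 6) ℝ :=
  Matrix.of fun k l : Fin 6 =>
    let i : Fin 3 := ⟨k.1 / 2, by omega⟩
    let r : Fin 3 := ⟨l.1 / 2, by omega⟩
    if l.1 % 2 = 0 then
      if k.1 % 2 = 0 then
        (1 / P.det) * ((a*b - (Q2 * Q1ᵀ).trace) * (if i = r then 1 else 0)
          + 2 * (Q2 * Q1ᵀ) r i)
      else
        (1 / P.det) * (-(2 * (a • Q2 - (Q1ᵀ).adjugate) r i))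
    else
      if k.1 % 2 = 0 then
        (1 / P.det) * (2 * (b • Q1ᵀ - Q2.adjugate) r i)
      else
        (1 / P.det) * (-((a*b - (Q1ᵀ * Q2).trace) * (if i = r then 1 else 0))
          - 2 * (Q1ᵀ * Q2) r i)

lemma adj_eq_aux (X : M3) :
    X.adjugate = X * X - X.trace • X + X.adjugate.trace • (1 : M3) := by
  ext i j
  fin_cases i <;> fin_cases j <;>
    simp [Matrix.adjugate_fin_three, Matrix.trace_fin_three, Matrix.mul_apply, Fin.sum_univ_three] <;>
    ring

lemma tr_adj_aux (A B : M3) : (A * B).adjugate.trace = (B * A).adjugate.trace := by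
  rw [Matrix.adjugate_mul_distrib, Matrix.adjugate_mul_distrib, Matrix.trace_mul_comm]

/-- The block form (transposed). -/
noncomputable def Kblk (a b : ℝ) (R Q : M3) : Matrix (Fin 3 ⊕ Fin 3) (Fin 3 ⊕ Fin 3) ℝ :=
  Matrix.fromBlocks
    ((a*b - (R * Q).trace) • (1 : M3) + (2:ℝ) • (Q * R))
    (-((2:ℝ) • (a • Q - R.adjugate)))
    ((2:ℝ) • (b • R - Q.adjugate))
    (-((a*b - (R * Q).trace) • (1 : M3)) - (2:ℝ) • (R * Q))

/-- Interleaving of the two triples of coframe elements. -/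
def e6 : Fin 6 ≃ Fin 3 ⊕ Fin 3 where
  toFun k := if k.1 % 2 = 0 then Sum.inl ⟨k.1 / 2, by omega⟩ else Sum.inr ⟨k.1 / 2, by omega⟩
  invFun := Sum.elim (fun i => ⟨2 * i.1, by omega⟩) (fun i => ⟨2 * i.1 + 1, by omega⟩)
  left_inv := by decide
  right_inv := by decide

lemma diag_aux (a b t p q u : ℝ) (X A U : M3) (hX : A = X * X - t • X + u • (1 : M3))
    (hU : U = (a * b) • X - (a * p) • (1 : M3) - (b * q) • (1 : M3) + A) :
    ((a*b - t) • (1 : M3) + (2:ℝ) • X) * ((a*b - t) • (1 : M3) + (2:ℝ) • X) - (4:ℝ) • U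
      = ((a*b - t)^2 + 4*(a*p + b*q) - 4*u) • (1 : M3) := by
  subst hU
  subst hX
  simp only [add_mul, mul_add, smul_mul_assoc, mul_smul_comm, one_mul, mul_one]
  module

lemma Kblk_sq (a b : ℝ) (R Q : M3) :
    Kblk a b R Q * Kblk a b R Q = ((a*b - (R * Q).trace)^2 + 4*(a * Q.det + b * R.det)
          - 4*((R * Q).adjugate.trace)) • (1 : Matrix (Fin 3 ⊕ Fin 3) (Fin 3 ⊕ Fin 3) ℝ) := by
  have hQ1 := Matrix.mul_adjugate Q
  have hQ2 := Matrix.adjugate_mul Q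
  have hR1 := Matrix.mul_adjugate R
  have hR2 := Matrix.adjugate_mul R
  have hX := adj_eq_aux (Q * R)
  have hY := adj_eq_aux (R * Q)
  rw [tr_adj_aux Q R, Matrix.trace_mul_comm Q R] at hX
  have hD1 := diag_aux a b (R * Q).trace Q.det R.det _ (Q * R) _
    ((a • Q - R.adjugate) * (b • R - Q.adjugate)) hX (by
      simp only [sub_mul, mul_sub, smul_mul_assoc, mul_smul_comm, hQ1, hR2,
        Matrix.adjugate_mul_distrib]
      module)
  have hD2 := diag_aux a b (R * Q).trace Q.det R.det _ (R * Q) _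
    ((b • R - Q.adjugate) * (a • Q - R.adjugate)) hY (by
      simp only [sub_mul, mul_sub, smul_mul_assoc, mul_smul_comm, hR1, hQ2,
        Matrix.adjugate_mul_distrib]
      module)
  have hU : (Q * R) * (a • Q - R.adjugate) = (a • Q - R.adjugate) * (R * Q) := by
    simp only [sub_mul, mul_sub, smul_mul_assoc, mul_smul_comm]
    rw [Matrix.mul_assoc Q R R.adjugate, hR1, ← Matrix.mul_assoc R.adjugate R Q, hR2,
      Matrix.mul_assoc]
    simp
  have hV : (R * Q) * (b • R - Q.adjugate) = (b • R - Q.adjugate) * (Q * R) := by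
    simp only [sub_mul, mul_sub, smul_mul_assoc, mul_smul_comm]
    rw [Matrix.mul_assoc R Q Q.adjugate, hQ1, ← Matrix.mul_assoc Q.adjugate Q R, hQ2,
      Matrix.mul_assoc]
    simp
  unfold Kblk
  rw [Matrix.fromBlocks_multiply, ← Matrix.fromBlocks_one, Matrix.fromBlocks_smul]
  generalize a • Q - R.adjugate = U at *
  generalize b • R - Q.adjugate = V at *
  congr 1
  · rw [← hD1]
    simp only [neg_mul, smul_mul_assoc, mul_smul_comm]
    module
  · simp only [neg_mul, mul_neg, add_mul, mul_sub, smul_mul_assoc, mul_smul_comm, one_mul,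
      mul_one, hU]
    module
  · simp only [neg_mul, mul_add, sub_mul, smul_mul_assoc, mul_smul_comm, one_mul,
      mul_one, hV]
    module
  · rw [← hD2]
    simp only [neg_mul, mul_neg, add_mul, mul_add, mul_sub, sub_mul, smul_mul_assoc,
      mul_smul_comm, one_mul, mul_one]
    module

lemma Jmat_eq (a b : ℝ) (P Q1 Q2 : M3) :
    Jmat a b P Q1 Q2 = (1 / P.det) • ((Kblk a b Q1ᵀ Q2)ᵀ.submatrix e6 e6) := by
  ext k l
  simp only [Jmat, Kblk, e6, Matrix.of_apply, Matrix.smul_apply, Matrix.submatrix_apply,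
    Matrix.transpose_apply, Equiv.coe_fn_mk, smul_eq_mul, Matrix.trace_mul_comm Q2]
  split_ifs <;> simp_all [Matrix.one_apply, eq_comm]

/-- `J_γ` squares to `(1/det P)²((ab − tr(Q₁ᵀQ₂))² + 4(a det Q₂ + b det Q₁)
− 4 tr(Adj(Q₁ᵀQ₂)))·Id` on the coframe; in particular `J_γ² = −Id` iff
`(det P)² = −(ab − tr(Q₁ᵀQ₂))² − 4(a det Q₂ + b det Q₁) + 4 tr(Adj(Q₁ᵀQ₂))`. -/
theorem stmt9 (a b : ℝ) (P Q1 Q2 : M3) (hP : P.det ≠ 0)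
    (h1 : (Q1ᵀ * P).IsSymm) (h2 : (Q2ᵀ * P).IsSymm) :
    Jmat a b P Q1 Q2 * Jmat a b P Q1 Q2
      = (((a*b - (Q1ᵀ * Q2).trace)^2 + 4*(a * Q2.det + b * Q1.det)
          - 4*((Q1ᵀ * Q2).adjugate.trace)) / P.det^2) • (1 : Matrix (Fin 6) (Fin 6) ℝ) ∧
    (Jmat a b P Q1 Q2 * Jmat a b P Q1 Q2 = -1 ↔
      P.det^2 = -((a*b - (Q1ᵀ * Q2).trace)^2) - 4*(a * Q2.det + b * Q1.det)
          + 4*((Q1ᵀ * Q2).adjugate.trace)) := by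
  have hsq : Jmat a b P Q1 Q2 * Jmat a b P Q1 Q2
      = (((a*b - (Q1ᵀ * Q2).trace)^2 + 4*(a * Q2.det + b * Q1.det)
          - 4*((Q1ᵀ * Q2).adjugate.trace)) / P.det^2) • (1 : Matrix (Fin 6) (Fin 6) ℝ) := by
    rw [Jmat_eq, smul_mul_assoc, mul_smul_comm, Matrix.submatrix_mul_equiv,
      ← Matrix.transpose_mul, Kblk_sq, Matrix.transpose_smul, Matrix.transpose_one,
      Matrix.submatrix_smul, Matrix.det_transpose]
    simp only [Pi.smul_apply, Matrix.submatrix_one_equiv, smul_smul]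
    congr 1
    field_simp
  refine ⟨hsq, ?_⟩
  rw [hsq]
  have hd : P.det ^ 2 ≠ 0 := pow_ne_zero 2 hP
  constructor
  · intro h
    have h0 := congrFun (congrFun h 0) 0
    simp only [Matrix.smul_apply, Matrix.neg_apply, Matrix.one_apply_eq, smul_eq_mul,
      mul_one] at h0
    rw [div_eq_iff hd] at h0
    linarith
  · intro h
    rw [show ((a*b - (Q1ᵀ * Q2).trace)^2 + 4*(a * Q2.det + b * Q1.det)
          - 4*((Q1ᵀ * Q2).adjugate.trace)) / P.det^2 = -1 by
      rw [div_eq_iff hd]; linarith]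
    simp
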